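/- arXiv:1111.4174 — 2 statements merged into one kernel-verified Lean document; each statement's English description precedes it below -/
import Mathlib

section
/- Let q be a prime power, m, n, T, μ positive integers, and k_1, …, k_{T+1} positive integers with k_1 + ⋯ + k_{T+1} = mn. Let S = (S_1, …, S_{T+1}) be a random variable with S_i taking values in F_q^{k_i}, let L be uniformly distributed on the set of all bijective F_q-linear maps on F_q^{mn}, independent of S, and let B be a fixed (mμ) × (mn) matrix over F_q. Then for every nonempty 𝒾 ⊆ {1, …, T} and every 0 < ρ ≤ 1, the conditional mutual information satisfies ρ · I(S_𝒾 ; B L S^t | L) ≤ q^{mρμ} · E[ P_{S_{𝒾̄}|S_𝒾}(S_{𝒾̄}|S_𝒾)^ρ ]. -/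
open scoped Classical
open Finset

noncomputable section

variable {Ω : Type*} [Fintype Ω]

/-- The probability P(X = x) of a random variable `X` on the finite
probability space `Ω` with probability mass function `p`. -/
def mprob {𝒳 : Type*} (p : Ω → ℝ) (X : Ω → 𝒳) (x : 𝒳) : ℝ :=
  ∑ ω, if X ω = x then p ω else 0

/-- The joint probability P(X = x, Y = y). -/
def jprob {𝒳 𝒴 : Type*} (p : Ω → ℝ) (X : Ω → 𝒳) (Y : Ω → 𝒴) (x : 𝒳) (y : 𝒴) : ℝ :=
  ∑ ω, if X ω = x ∧ Y ω = y then p ω else 0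

/-- The conditional probability P(X = x | Y = y). -/
def cprob {𝒳 𝒴 : Type*} (p : Ω → ℝ) (X : Ω → 𝒳) (Y : Ω → 𝒴) (x : 𝒳) (y : 𝒴) : ℝ :=
  jprob p X Y x y / mprob p Y y

/-- The conditional probability mass function of `p` given the event `Y = y`. -/
def condDist {𝒴 : Type*} (p : Ω → ℝ) (Y : Ω → 𝒴) (y : 𝒴) : Ω → ℝ :=
  fun ω => if Y ω = y then p ω / mprob p Y y else 0

/-- The probability of an event `E`. -/
def prEvent (p : Ω → ℝ) (E : Ω → Prop) : ℝ :=
  ∑ ω, if E ω then p ω else 0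

/-- Shannon entropy H(X) in nats. -/
def entropy {𝒳 : Type*} [Fintype 𝒳] (p : Ω → ℝ) (X : Ω → 𝒳) : ℝ :=
  -∑ x, mprob p X x * Real.log (mprob p X x)

/-- Conditional Shannon entropy H(X|Y) in nats. -/
def condEntropy {𝒳 𝒴 : Type*} [Fintype 𝒳] [Fintype 𝒴] (p : Ω → ℝ) (X : Ω → 𝒳) (Y : Ω → 𝒴) : ℝ :=
  -∑ x, ∑ y, jprob p X Y x y * Real.log (cprob p X Y x y)

/-- Shannon mutual information I(X;Y) in nats. -/
def mutInfo {𝒳 𝒴 : Type*} [Fintype 𝒳] [Fintype 𝒴] (p : Ω → ℝ) (X : Ω → 𝒳) (Y : Ω → 𝒴) : ℝ :=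
  ∑ x, ∑ y, jprob p X Y x y * Real.log (jprob p X Y x y / (mprob p X x * mprob p Y y))

/-- The expectation E[ P_{X|Y}(X|Y)^ρ ]. -/
def expPow {𝒳 𝒴 : Type*} (p : Ω → ℝ) (X : Ω → 𝒳) (Y : Ω → 𝒴) (ρ : ℝ) : ℝ :=
  ∑ ω, p ω * (cprob p X Y (X ω) (Y ω)) ^ ρ

end
/-- Concatenation of the messages `s = (s_1, …, s_{T+1})`, with `s_i ∈ F^{k_i}` and
`∑ k_i = mn`, into a single vector `S^t ∈ F^{mn}`. -/
noncomputable def concat {T m n : ℕ} {F : Type*} (k : Fin (T + 1) → ℕ)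
    (h : ∑ i, k i = m * n) (s : ∀ i, Fin (k i) → F) : Fin (m * n) → F :=
  fun j =>
    let x := (Fintype.equivFinOfCardEq
      (by simp [h] : Fintype.card (Σ i : Fin (T + 1), Fin (k i)) = m * n)).symm j
    s x.1 x.2

theorem mul_log_div_le {j a b M : ℝ} (hj : 0 ≤ j) (ha : j ≤ a) (hb : j ≤ b) (hM : 0 < M) :
    j * Real.log (j / (a * b)) ≤ j * Real.log (M * (j / a)) - j + j / b / M := by
  rcases hj.eq_or_lt with rfl | hj
  · simp
  have ha' : 0 < a := hj.trans_le ha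
  have hb' : 0 < b := hj.trans_le hb
  have h1 : j / (a * b) = (M * (j / a)) * (M * b)⁻¹ := by field_simp
  rw [h1, Real.log_mul (by positivity) (by positivity)]
  have h2 := Real.log_le_sub_one_of_pos (show 0 < (M * b)⁻¹ by positivity)
  have h3 : j / b / M = j * (M * b)⁻¹ := by field_simp
  rw [h3]
  nlinarith

theorem sum_mul_comp_eq {Ω 𝒮 : Type*} [Fintype Ω] [Fintype 𝒮] (p : Ω → ℝ) (S : Ω → 𝒮)
    (g : 𝒮 → ℝ) : ∑ ω, p ω * g (S ω) = ∑ s, mprob p S s * g s := by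
  simp only [mprob, Finset.sum_mul, ite_mul, zero_mul]
  rw [Finset.sum_comm]
  simp

theorem sum_condDist_mul_eq {Ω 𝒮 𝓛 : Type*} [Fintype Ω] [Fintype 𝒮] (p : Ω → ℝ)
    (S : Ω → 𝒮) (L : Ω → 𝓛) (ℓ : 𝓛) (hℓ : mprob p L ℓ ≠ 0)
    (hind : ∀ s, jprob p S L s ℓ = mprob p S s * mprob p L ℓ) (g : 𝓛 → 𝒮 → ℝ) :
    ∑ ω, condDist p L ℓ ω * g (L ω) (S ω) = ∑ s, mprob p S s * g ℓ s := by
  have h : ∀ s, mprob p S s = mprob (condDist p L ℓ) S s := by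
    intro s
    rw [eq_div_of_mul_eq hℓ (hind s).symm, jprob, Finset.sum_div, mprob.eq_1 (condDist p L ℓ)]
    refine Finset.sum_congr rfl fun ω _ => ?_
    by_cases h1 : S ω = s <;> by_cases h2 : L ω = ℓ <;> simp [condDist, h1, h2]
  simp only [h]
  rw [← sum_mul_comp_eq]
  refine Finset.sum_congr rfl fun ω _ => ?_
  by_cases h2 : L ω = ℓ <;> simp [condDist, h2]

theorem mprob_eq_sum_mul {Ω 𝒳 : Type*} [Fintype Ω] (p : Ω → ℝ) (X : Ω → 𝒳) (x : 𝒳) :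
    mprob p X x = ∑ ω, p ω * if X ω = x then 1 else 0 := by
  simp [mprob]

theorem jprob_eq_sum_mul {Ω 𝒳 𝒴 : Type*} [Fintype Ω] (p : Ω → ℝ) (X : Ω → 𝒳) (Y : Ω → 𝒴)
    (x : 𝒳) (y : 𝒴) :
    jprob p X Y x y = ∑ ω, p ω * if X ω = x ∧ Y ω = y then 1 else 0 := by
  simp only [jprob, mul_ite, mul_one, mul_zero]

theorem mutInfo_condDist {Ω 𝒮 𝓛 𝒳 𝒵 : Type*} [Fintype Ω] [Fintype 𝒮] [Fintype 𝒳] [Fintype 𝒵]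
    (p : Ω → ℝ) (S : Ω → 𝒮) (L : Ω → 𝓛) (ℓ : 𝓛) (hℓ : mprob p L ℓ ≠ 0)
    (hind : ∀ s, jprob p S L s ℓ = mprob p S s * mprob p L ℓ)
    (X : 𝒮 → 𝒳) (Z : 𝓛 → 𝒮 → 𝒵) :
    mutInfo (condDist p L ℓ) (fun ω => X (S ω)) (fun ω => Z (L ω) (S ω)) =
      mutInfo (mprob p S) X (Z ℓ) := by
  have h := sum_condDist_mul_eq p S L ℓ hℓ hind
  have h1 : ∀ x z, jprob (condDist p L ℓ) (fun ω => X (S ω)) (fun ω => Z (L ω) (S ω)) x z =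
      jprob (mprob p S) X (Z ℓ) x z := fun x z => by
    rw [jprob_eq_sum_mul, jprob_eq_sum_mul]
    exact h fun l s => if X s = x ∧ Z l s = z then 1 else 0
  have h2 : ∀ x, mprob (condDist p L ℓ) (fun ω => X (S ω)) x = mprob (mprob p S) X x :=
    fun x => by
    rw [mprob_eq_sum_mul, mprob_eq_sum_mul]
    exact h fun _ s => if X s = x then 1 else 0
  have h3 : ∀ z, mprob (condDist p L ℓ) (fun ω => Z (L ω) (S ω)) z =
      mprob (mprob p S) (Z ℓ) z := fun z => by
    rw [mprob_eq_sum_mul, mprob_eq_sum_mul]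
    exact h fun l s => if Z l s = z then 1 else 0
  simp only [mutInfo, h1, h2, h3]

theorem expPow_comp {Ω 𝒮 𝒳 𝒲 : Type*} [Fintype Ω] [Fintype 𝒮]
    (p : Ω → ℝ) (S : Ω → 𝒮) (W : 𝒮 → 𝒲) (X : 𝒮 → 𝒳) (ρ : ℝ) :
    expPow p (fun ω => W (S ω)) (fun ω => X (S ω)) ρ = expPow (mprob p S) W X ρ := by
  have h1 : ∀ w x, jprob p (fun ω => W (S ω)) (fun ω => X (S ω)) w x =
      jprob (mprob p S) W X w x := fun w x => by
    rw [jprob_eq_sum_mul, jprob_eq_sum_mul]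
    exact sum_mul_comp_eq p S fun s => if W s = w ∧ X s = x then 1 else 0
  have h2 : ∀ x, mprob p (fun ω => X (S ω)) x = mprob (mprob p S) X x := fun x => by
    rw [mprob_eq_sum_mul, mprob_eq_sum_mul]
    exact sum_mul_comp_eq p S fun s => if X s = x then 1 else 0
  simp only [expPow, cprob, h1, h2]
  exact sum_mul_comp_eq p S fun s =>
    (jprob (mprob p S) W X (W s) (X s) / mprob (mprob p S) X (X s)) ^ ρ

theorem jprob_nonneg {Ω 𝒳 𝒴 : Type*} [Fintype Ω] {p : Ω → ℝ} (hp : ∀ ω, 0 ≤ p ω)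
    (X : Ω → 𝒳) (Y : Ω → 𝒴) (x : 𝒳) (y : 𝒴) : 0 ≤ jprob p X Y x y :=
  Finset.sum_nonneg fun ω _ => by split_ifs <;> simp [hp]

theorem mprob_nonneg {Ω 𝒳 : Type*} [Fintype Ω] {p : Ω → ℝ} (hp : ∀ ω, 0 ≤ p ω)
    (X : Ω → 𝒳) (x : 𝒳) : 0 ≤ mprob p X x :=
  Finset.sum_nonneg fun ω _ => by split_ifs <;> simp [hp]

theorem jprob_comm {Ω 𝒳 𝒴 : Type*} [Fintype Ω] (p : Ω → ℝ)
    (X : Ω → 𝒳) (Y : Ω → 𝒴) (x : 𝒳) (y : 𝒴) : jprob p X Y x y = jprob p Y X y x := by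
  simp only [jprob, and_comm]

theorem jprob_le_mprob_right {Ω 𝒳 𝒴 : Type*} [Fintype Ω] {p : Ω → ℝ} (hp : ∀ ω, 0 ≤ p ω)
    (X : Ω → 𝒳) (Y : Ω → 𝒴) (x : 𝒳) (y : 𝒴) : jprob p X Y x y ≤ mprob p Y y :=
  Finset.sum_le_sum fun ω _ => by
    by_cases h1 : X ω = x <;> by_cases h2 : Y ω = y <;> simp [h1, h2, hp]

theorem le_jprob_apply {Ω 𝒳 𝒴 : Type*} [Fintype Ω] {p : Ω → ℝ} (hp : ∀ ω, 0 ≤ p ω)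
    (X : Ω → 𝒳) (Y : Ω → 𝒴) (ω : Ω) : p ω ≤ jprob p X Y (X ω) (Y ω) := by
  have h := Finset.single_le_sum (f := fun ω' => if X ω' = X ω ∧ Y ω' = Y ω then p ω' else 0)
    (fun ω' _ => by split_ifs <;> simp [hp]) (Finset.mem_univ ω)
  simpa [jprob] using h

theorem sum_sum_jprob_mul {Ω 𝒳 𝒴 : Type*} [Fintype Ω] [Fintype 𝒳] [Fintype 𝒴] (p : Ω → ℝ)
    (X : Ω → 𝒳) (Y : Ω → 𝒴) (g : 𝒳 → 𝒴 → ℝ) :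
    ∑ x, ∑ y, jprob p X Y x y * g x y = ∑ ω, p ω * g (X ω) (Y ω) := by
  rw [sum_mul_comp_eq p (fun ω => (X ω, Y ω)) (fun a => g a.1 a.2), Fintype.sum_prod_type]
  simp [jprob, mprob, Prod.ext_iff]

theorem sum_jprob_left {Ω 𝒳 𝒴 : Type*} [Fintype Ω] [Fintype 𝒳] (p : Ω → ℝ)
    (X : Ω → 𝒳) (Y : Ω → 𝒴) (y : 𝒴) : ∑ x, jprob p X Y x y = mprob p Y y := by
  simp only [jprob, mprob, ite_and]
  rw [Finset.sum_comm]
  simp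

/-- Replacing the output law by the uniform law on a set `A` carrying the output can only
increase the divergence. -/
theorem mutInfo_le_sum_log {𝒮 𝒳 𝒵 : Type*} [Fintype 𝒮] [Fintype 𝒳] [Fintype 𝒵]
    {r : 𝒮 → ℝ} (hr0 : ∀ s, 0 ≤ r s) (hr1 : ∑ s, r s = 1) (X : 𝒮 → 𝒳) (Z : 𝒮 → 𝒵)
    (A : Finset 𝒵) (hA : A.Nonempty) (hZ : ∀ s, Z s ∈ A) :
    mutInfo r X Z ≤ ∑ s, r s * Real.log (#A * cprob r Z X (Z s) (X s)) := by
  have hM : (0 : ℝ) < #A := by exact_mod_cast hA.card_pos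
  have h1 : ∑ x, ∑ z, jprob r X Z x z * Real.log (#A * cprob r Z X z x) =
      ∑ s, r s * Real.log (#A * cprob r Z X (Z s) (X s)) :=
    sum_sum_jprob_mul r X Z fun x z => Real.log (#A * cprob r Z X z x)
  have h2 : ∑ x, ∑ z, jprob r X Z x z = 1 := by
    simpa [hr1] using sum_sum_jprob_mul r X Z fun _ _ => 1
  have h3 : ∑ x, ∑ z, jprob r X Z x z / mprob r Z z / #A ≤ 1 := by
    rw [Finset.sum_comm]
    simp only [← Finset.sum_div, sum_jprob_left]
    rw [div_le_one hM, ← Finset.sum_subset (Finset.subset_univ A)]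
    · simpa using Finset.sum_le_card_nsmul A (fun z => mprob r Z z / mprob r Z z) 1
        fun z _ => div_self_le_one _
    · intro z _ hz
      have : mprob r Z z = 0 := Finset.sum_eq_zero fun s _ =>
        if_neg fun (h : Z s = z) => hz (h ▸ hZ s)
      simp [this]
  have h4 : mutInfo r X Z ≤ ∑ x, ∑ z, (jprob r X Z x z * Real.log (#A * cprob r Z X z x) -
      jprob r X Z x z + jprob r X Z x z / mprob r Z z / #A) := by
    refine Finset.sum_le_sum fun x _ => Finset.sum_le_sum fun z _ => ?_
    rw [cprob, jprob_comm r Z X]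
    refine mul_log_div_le (jprob_nonneg hr0 ..) ?_ (jprob_le_mprob_right hr0 ..) hM
    rw [jprob_comm]
    exact jprob_le_mprob_right hr0 ..
  simp only [Finset.sum_add_distrib, Finset.sum_sub_distrib] at h4
  linarith

theorem sum_cprob_le {𝒮 𝓛 𝒳 𝒲 𝒵 : Type*} [Fintype 𝒮] [Fintype 𝓛]
    {r : 𝒮 → ℝ} (hr0 : ∀ s, 0 ≤ r s) (X : 𝒮 → 𝒳) (W : 𝒮 → 𝒲) (Z : 𝓛 → 𝒮 → 𝒵) {M : ℝ}
    (hM : 0 < M)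
    (hcoll : ∀ s s', s' ≠ s → #{ℓ | Z ℓ s' = Z ℓ s} * M ≤ Fintype.card 𝓛)
    (s : 𝒮) (hs : 0 < r s) :
    ∑ ℓ, cprob r (Z ℓ) X (Z ℓ s) (X s) ≤
      Fintype.card 𝓛 * (cprob r W X (W s) (X s) + 1 / M) := by
  have hx : 0 < mprob r X (X s) :=
    hs.trans_le ((le_jprob_apply hr0 W X s).trans (jprob_le_mprob_right hr0 ..))
  simp only [cprob, ← Finset.sum_div]
  rw [div_le_iff₀ hx]
  have h0 : (Fintype.card 𝓛 : ℝ) * (jprob r W X (W s) (X s) / mprob r X (X s) + 1 / M) *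
      mprob r X (X s) =
      Fintype.card 𝓛 * jprob r W X (W s) (X s) + Fintype.card 𝓛 / M * mprob r X (X s) := by
    field_simp
  rw [h0]
  calc ∑ ℓ, jprob r (Z ℓ) X (Z ℓ s) (X s)
      = ∑ s', if X s' = X s then r s' * #{ℓ | Z ℓ s' = Z ℓ s} else 0 := by
        simp only [jprob]
        rw [Finset.sum_comm]
        refine Finset.sum_congr rfl fun s' _ => ?_
        by_cases h : X s' = X s
        · simp [h, Finset.sum_ite, mul_comm]
        · simp [h]
    _ ≤ ∑ s', ((if s' = s then r s' * Fintype.card 𝓛 else 0) +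
          Fintype.card 𝓛 / M * if X s' = X s then r s' else 0) := by
        refine Finset.sum_le_sum fun s' _ => ?_
        have hc : (0 : ℝ) ≤ Fintype.card 𝓛 / M := by positivity
        by_cases h : s' = s
        · subst h
          simp only [if_true, Finset.filter_true, Finset.card_univ]
          have := mul_nonneg hc (hr0 s')
          linarith
        · by_cases h' : X s' = X s
          · simp only [h, h', if_true, if_false, zero_add]
            rw [mul_comm]
            exact mul_le_mul_of_nonneg_right ((le_div_iff₀ hM).2 (hcoll s s' h)) (hr0 s')
          · simp [h, h']
    _ = r s * Fintype.card 𝓛 + Fintype.card 𝓛 / M * mprob r X (X s) := by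
        rw [Finset.sum_add_distrib, ← Finset.mul_sum]
        simp [mprob]
    _ ≤ _ := by
        have := mul_le_mul_of_nonneg_right (le_jprob_apply hr0 W X s)
          (Nat.cast_nonneg (α := ℝ) (Fintype.card 𝓛))
        linarith

theorem mul_log_one_add_le {x ρ : ℝ} (hx : 0 ≤ x) (hρ0 : 0 < ρ) (hρ1 : ρ ≤ 1) :
    ρ * Real.log (1 + x) ≤ x ^ ρ := by
  have h := Real.rpow_add_le_add_rpow zero_le_one hx hρ0.le hρ1
  rw [← Real.log_rpow (by positivity)]
  rw [Real.one_rpow] at h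
  have := Real.log_le_sub_one_of_pos (show 0 < (1 + x) ^ ρ by positivity)
  linarith

theorem mul_average_log_le {𝓛 : Type*} [Fintype 𝓛] [Nonempty 𝓛] {c : 𝓛 → ℝ}
    (hc : ∀ ℓ, 0 < c ℓ) {M a ρ : ℝ} (hM : 0 < M) (ha : 0 ≤ a)
    (h : ∑ ℓ, c ℓ ≤ Fintype.card 𝓛 * (a + 1 / M)) (hρ0 : 0 < ρ) (hρ1 : ρ ≤ 1) :
    ρ * ∑ ℓ, 1 / (Fintype.card 𝓛 : ℝ) * Real.log (M * c ℓ) ≤ M ^ ρ * a ^ ρ := by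
  have hN : (0 : ℝ) < Fintype.card 𝓛 := by exact_mod_cast Fintype.card_pos
  have hb : 0 < 1 + M * a := by positivity
  have h1 : ∑ ℓ, Real.log (M * c ℓ) ≤ Fintype.card 𝓛 * Real.log (1 + M * a) := by
    calc ∑ ℓ, Real.log (M * c ℓ)
        ≤ ∑ ℓ, (Real.log (1 + M * a) + (M / (1 + M * a) * c ℓ - 1)) := by
          refine Finset.sum_le_sum fun ℓ _ => ?_
          have hcl := hc ℓ
          have := Real.log_le_sub_one_of_pos (show 0 < M * c ℓ / (1 + M * a) by positivity)
          rw [Real.log_div (by positivity) hb.ne'] at this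
          have e : M / (1 + M * a) * c ℓ = M * c ℓ / (1 + M * a) := by ring
          linarith
      _ = Fintype.card 𝓛 * Real.log (1 + M * a) +
          (M / (1 + M * a) * ∑ ℓ, c ℓ - Fintype.card 𝓛) := by
          simp [Finset.sum_add_distrib, Finset.sum_sub_distrib, Finset.mul_sum]
      _ ≤ _ := by
          have h2 := mul_le_mul_of_nonneg_left h (show 0 ≤ M / (1 + M * a) by positivity)
          have e : M / (1 + M * a) * (Fintype.card 𝓛 * (a + 1 / M)) = Fintype.card 𝓛 := by
            field_simp
            ring
          linarith
  rw [← Finset.mul_sum, ← Real.mul_rpow hM.le ha]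
  refine le_trans ?_ (mul_log_one_add_le (by positivity) hρ0 hρ1)
  refine mul_le_mul_of_nonneg_left ?_ hρ0.le
  rwa [one_div, inv_mul_le_iff₀ hN]

/-- Privacy amplification by a uniformly chosen member of a universal family of hash functions
with values in a set `A`. -/
theorem mul_average_mutInfo_le {𝒮 𝓛 𝒳 𝒲 𝒵 : Type*} [Fintype 𝒮] [Fintype 𝓛] [Nonempty 𝓛]
    [Fintype 𝒳] [Fintype 𝒵] {r : 𝒮 → ℝ} (hr0 : ∀ s, 0 ≤ r s) (hr1 : ∑ s, r s = 1)
    (X : 𝒮 → 𝒳) (W : 𝒮 → 𝒲) (Z : 𝓛 → 𝒮 → 𝒵) (A : Finset 𝒵) (hA : A.Nonempty)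
    (hZ : ∀ ℓ s, Z ℓ s ∈ A)
    (hcoll : ∀ s s', s' ≠ s → #{ℓ | Z ℓ s' = Z ℓ s} * #A ≤ Fintype.card 𝓛)
    {ρ : ℝ} (hρ0 : 0 < ρ) (hρ1 : ρ ≤ 1) :
    ρ * ∑ ℓ, 1 / (Fintype.card 𝓛 : ℝ) * mutInfo r X (Z ℓ) ≤ (#A : ℝ) ^ ρ * expPow r W X ρ := by
  have hM : (0 : ℝ) < #A := by exact_mod_cast hA.card_pos
  calc ρ * ∑ ℓ, 1 / (Fintype.card 𝓛 : ℝ) * mutInfo r X (Z ℓ)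
      ≤ ρ * ∑ ℓ, 1 / (Fintype.card 𝓛 : ℝ) *
          ∑ s, r s * Real.log (#A * cprob r (Z ℓ) X (Z ℓ s) (X s)) := by
        gcongr with ℓ
        exact mutInfo_le_sum_log hr0 hr1 X (Z ℓ) A hA (hZ ℓ)
    _ = ∑ s, r s * (ρ * ∑ ℓ, 1 / (Fintype.card 𝓛 : ℝ) *
          Real.log (#A * cprob r (Z ℓ) X (Z ℓ s) (X s))) := by
        simp only [Finset.mul_sum]
        rw [Finset.sum_comm]
        refine Finset.sum_congr rfl fun s _ => Finset.sum_congr rfl fun ℓ _ => ?_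
        ring
    _ ≤ ∑ s, r s * ((#A : ℝ) ^ ρ * cprob r W X (W s) (X s) ^ ρ) := by
        refine Finset.sum_le_sum fun s _ => ?_
        rcases (hr0 s).eq_or_lt with hs | hs
        · simp [← hs]
        refine mul_le_mul_of_nonneg_left (mul_average_log_le (fun ℓ => ?_) hM
          (div_nonneg (jprob_nonneg hr0 ..) (mprob_nonneg hr0 ..))
          (sum_cprob_le hr0 X W Z hM (fun s s' h => by exact_mod_cast hcoll s s' h) s hs)
          hρ0 hρ1) (hr0 s)
        have hj := hs.trans_le (le_jprob_apply hr0 (Z ℓ) X s)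
        exact div_pos hj (hj.trans_le (jprob_le_mprob_right hr0 ..))
    _ = _ := by
        simp only [expPow, Finset.mul_sum]
        refine Finset.sum_congr rfl fun s _ => ?_
        ring

theorem exists_GL_mulVec_eq {F : Type*} [Field F] {N : ℕ} {u v : Fin N → F} (hu : u ≠ 0)
    (hv : v ≠ 0) : ∃ g : GL (Fin N) F, (g : Matrix (Fin N) (Fin N) F).mulVec u = v := by
  let f := (LinearEquiv.toSpanNonzeroSingleton F _ u hu).symm ≪≫ₗ
    LinearEquiv.toSpanNonzeroSingleton F _ v hv
  obtain ⟨e, he⟩ := Submodule.exists_linearEquiv_restrict_eq f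
  refine ⟨Matrix.GeneralLinearGroup.toLin.symm
    (LinearMap.GeneralLinearGroup.ofLinearEquiv e), ?_⟩
  have h1 : (Matrix.GeneralLinearGroup.toLin.symm
      (LinearMap.GeneralLinearGroup.ofLinearEquiv e) : Matrix (Fin N) (Fin N) F) =
      LinearMap.toMatrix' e.toLinearMap := rfl
  have h2 : f (LinearEquiv.toSpanNonzeroSingleton F _ u hu 1) =
      LinearEquiv.toSpanNonzeroSingleton F _ v hv 1 := by
    simp only [f, LinearEquiv.trans_apply, LinearEquiv.symm_apply_apply]
  have h3 := he (LinearEquiv.toSpanNonzeroSingleton F _ u hu 1)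
  rw [h2] at h3
  rw [h1, LinearMap.toMatrix'_mulVec]
  simpa using h3.symm

theorem card_GL_mulVec_eq {F : Type*} [Field F] [Fintype F] {N : ℕ} (u : Fin N → F)
    {v w : Fin N → F} (hv : v ≠ 0) (hw : w ≠ 0) :
    #{ℓ : GL (Fin N) F | (ℓ : Matrix (Fin N) (Fin N) F).mulVec u = v} =
      #{ℓ : GL (Fin N) F | (ℓ : Matrix (Fin N) (Fin N) F).mulVec u = w} := by
  obtain ⟨g, hg⟩ := exists_GL_mulVec_eq hv hw
  refine Finset.card_equiv (Equiv.mulLeft g) fun ℓ => ?_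
  have hinj := Matrix.mulVec_injective_of_isUnit g.isUnit
  simp only [Finset.mem_filter, Finset.mem_univ, true_and, Equiv.coe_mulLeft, Units.val_mul,
    ← Matrix.mulVec_mulVec, ← hg, hinj.eq_iff]

theorem card_image_mulVec_mul_card_ker {F : Type*} [Field F] [Fintype F] {M N : ℕ}
    (B : Matrix (Fin M) (Fin N) F) :
    #(univ.image B.mulVec) * #{v | B.mulVec v = 0} = Fintype.card (Fin N → F) := by
  have h := B.mulVecLin.toAddMonoidHom.ker.card_mul_index
  rw [AddSubgroup.index_ker] at h
  rw [← Nat.card_eq_fintype_card, ← h, mul_comm]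
  congr 1
  · exact (Nat.subtype_card _ fun v => by simp).symm
  · exact (Nat.subtype_card _ fun v => by simp).symm

/-- A uniformly random invertible matrix followed by `B` is a universal hash family onto the
range of `B`. -/
theorem card_GL_mulVec_eq_zero_mul_le {F : Type*} [Field F] [Fintype F] {M N : ℕ}
    (B : Matrix (Fin M) (Fin N) F) {u : Fin N → F} (hu : u ≠ 0) :
    #{ℓ : GL (Fin N) F | B.mulVec ((ℓ : Matrix (Fin N) (Fin N) F).mulVec u) = 0} *
      #(univ.image B.mulVec) ≤ Fintype.card (GL (Fin N) F) := by
  set a := #(univ.image B.mulVec)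
  set c := #{ℓ : GL (Fin N) F | (ℓ : Matrix (Fin N) (Fin N) F).mulVec u = u}
  have hne : ∀ ℓ : GL (Fin N) F, (ℓ : Matrix (Fin N) (Fin N) F).mulVec u ≠ 0 := fun ℓ h =>
    hu (Matrix.mulVec_injective_of_isUnit ℓ.isUnit (h.trans (Matrix.mulVec_zero _).symm))
  have h1 : Fintype.card (GL (Fin N) F) = (Fintype.card (Fin N → F) - 1) * c := by
    rw [← Finset.card_univ, Finset.card_eq_sum_card_fiberwise (t := univ.erase 0)
      (f := fun ℓ : GL (Fin N) F => (ℓ : Matrix (Fin N) (Fin N) F).mulVec u)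
      (fun ℓ _ => by simpa using hne ℓ),
      Finset.sum_congr rfl (fun v hv => card_GL_mulVec_eq u (Finset.ne_of_mem_erase hv) hu)]
    simp [c]
  have h2 : #{ℓ : GL (Fin N) F | B.mulVec ((ℓ : Matrix (Fin N) (Fin N) F).mulVec u) = 0} =
      (#{v | B.mulVec v = 0} - 1) * c := by
    rw [Finset.card_eq_sum_card_fiberwise (t := ({v | B.mulVec v = 0} : Finset _).erase 0)
      (f := fun ℓ : GL (Fin N) F => (ℓ : Matrix (Fin N) (Fin N) F).mulVec u)
      (fun ℓ hℓ => by simpa [hne ℓ] using hℓ)]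
    rw [Finset.sum_const_nat (m := c), Finset.card_erase_of_mem (by simp)]
    intro v hv
    rw [Finset.mem_erase, Finset.mem_filter] at hv
    refine Eq.trans ?_ (card_GL_mulVec_eq u hv.1 hu)
    rw [Finset.filter_filter]
    congr 1
    ext ℓ
    simp only [Finset.mem_filter, Finset.mem_univ, true_and, and_iff_right_iff_imp]
    rintro rfl
    exact hv.2.2
  have ha : 1 ≤ a := Finset.card_pos.2 (Finset.univ_nonempty.image _)
  rw [h1, h2, ← card_image_mulVec_mul_card_ker B, mul_right_comm]
  refine Nat.mul_le_mul_right c ?_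
  rw [Nat.sub_mul, one_mul, mul_comm a]
  exact Nat.sub_le_sub_left ha _

theorem concat_injective {T m n : ℕ} {F : Type*} (k : Fin (T + 1) → ℕ)
    (h : ∑ i, k i = m * n) : Function.Injective (concat (F := F) k h) := by
  intro s s' hs
  have key : ∀ x : Σ i : Fin (T + 1), Fin (k i), s x.1 x.2 = s' x.1 x.2 := fun x => by
    obtain ⟨j, rfl⟩ := (Fintype.equivFinOfCardEq
      (by simp [h] : Fintype.card (Σ i : Fin (T + 1), Fin (k i)) = m * n)).symm.surjective x
    exact congrFun hs j
  funext i j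
  exact key ⟨i, j⟩

/-- In the setting of the random-precoder scheme, the
conditional mutual information (the average over realizations `ℓ` of `L` of
`I(S_𝒾 ; BLSᵗ | L = ℓ)`) satisfies
`ρ · I(S_𝒾 ; BLSᵗ | L) ≤ q^{mρμ} · E[P_{S_𝒾̄|S_𝒾}(S_𝒾̄|S_𝒾)^ρ]`
for every nonempty `𝒾 ⊆ {1, …, T}` and every `0 < ρ ≤ 1`. -/
theorem rho_cond_mutual_info_bound
    {F : Type*} [Field F] [Fintype F] [DecidableEq F]
    (m n T μ : ℕ) (hm : 0 < m) (hn : 0 < n) (hT : 0 < T) (hμ : 0 < μ)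
    (k : Fin (T + 1) → ℕ) (hkpos : ∀ i, 0 < k i) (hk : ∑ i, k i = m * n)
    {Ω : Type*} [Fintype Ω] (p : Ω → ℝ) (hp0 : ∀ ω, 0 ≤ p ω) (hp1 : ∑ ω, p ω = 1)
    (S : Ω → (∀ i : Fin (T + 1), Fin (k i) → F))
    (L : Ω → GL (Fin (m * n)) F)
    -- L is uniformly distributed
    (hLunif : ∀ ℓ, mprob p L ℓ = 1 / (Nat.card (GL (Fin (m * n)) F) : ℝ))
    -- L is statistically independent of S
    (hLS : ∀ s ℓ, jprob p S L s ℓ = mprob p S s * mprob p L ℓ)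
    (B : Matrix (Fin (m * μ)) (Fin (m * n)) F)
    (𝒾 : Finset (Fin (T + 1))) (h𝒾 : 𝒾.Nonempty) (h𝒾' : Fin.last T ∉ 𝒾)
    (ρ : ℝ) (hρ0 : 0 < ρ) (hρ1 : ρ ≤ 1) :
    ρ * (∑ ℓ : GL (Fin (m * n)) F, mprob p L ℓ *
        mutInfo (condDist p L ℓ)
          (fun ω => fun i : 𝒾 => S ω i.1)
          (fun ω => B.mulVec
            (((L ω : Matrix (Fin (m * n)) (Fin (m * n)) F)).mulVec (concat k hk (S ω)))))
      ≤ (Fintype.card F : ℝ) ^ ((m : ℝ) * ρ * (μ : ℝ)) *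
          expPow p (fun ω => fun i : (𝒾ᶜ : Finset (Fin (T + 1))) => S ω i.1)
            (fun ω => fun i : 𝒾 => S ω i.1) ρ := by
  have hN : mprob p L = fun _ => 1 / (Fintype.card (GL (Fin (m * n)) F) : ℝ) :=
    funext fun ℓ => by rw [hLunif, Nat.card_eq_fintype_card]
  have hL0 : ∀ ℓ, mprob p L ℓ ≠ 0 := fun ℓ => by
    rw [hN]
    exact one_div_ne_zero (Nat.cast_ne_zero.2 Fintype.card_ne_zero)
  have hr1 : ∑ s, mprob p S s = 1 := by
    simpa [hp1] using (sum_mul_comp_eq p S fun _ => 1).symm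
  have hcond : ∀ ℓ : GL (Fin (m * n)) F,
      mutInfo (condDist p L ℓ) (fun ω => fun i : 𝒾 => S ω i.1)
        (fun ω => B.mulVec
          (((L ω : Matrix (Fin (m * n)) (Fin (m * n)) F)).mulVec (concat k hk (S ω)))) =
      mutInfo (mprob p S) (fun s => fun i : 𝒾 => s i.1)
        (fun s => B.mulVec
          ((ℓ : Matrix (Fin (m * n)) (Fin (m * n)) F).mulVec (concat k hk s))) := fun ℓ =>
    mutInfo_condDist p S L ℓ (hL0 ℓ) (fun s => hLS s ℓ)
      (fun s => fun i : 𝒾 => s i.1)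
      fun (ℓ : GL (Fin (m * n)) F) s => B.mulVec
        ((ℓ : Matrix (Fin (m * n)) (Fin (m * n)) F).mulVec (concat k hk s))
  simp only [hcond, hN]
  rw [expPow_comp p S (fun s => fun i : (𝒾ᶜ : Finset (Fin (T + 1))) => s i.1)
    (fun s => fun i : 𝒾 => s i.1) ρ]
  refine (mul_average_mutInfo_le (mprob_nonneg hp0 S) hr1 _
    (fun s => fun i : (𝒾ᶜ : Finset (Fin (T + 1))) => s i.1) _ (univ.image B.mulVec)
    (Finset.univ_nonempty.image _) (fun ℓ s => Finset.mem_image_of_mem _ (Finset.mem_univ _))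
    (fun s s' hs => ?_) hρ0 hρ1).trans ?_
  · convert card_GL_mulVec_eq_zero_mul_le B
      (sub_ne_zero.2 ((concat_injective k hk).ne hs)) using 4
    · funext ℓ
      rw [Matrix.mulVec_sub, Matrix.mulVec_sub, sub_eq_zero]
    · ext
      simp
  · refine mul_le_mul_of_nonneg_right ?_ (Finset.sum_nonneg fun s _ =>
      mul_nonneg (mprob_nonneg hp0 S s) (Real.rpow_nonneg (div_nonneg
        (jprob_nonneg (mprob_nonneg hp0 S) ..) (mprob_nonneg (mprob_nonneg hp0 S) ..)) ρ))
    have hcard : (#(univ.image B.mulVec) : ℝ) ≤ (Fintype.card F : ℝ) ^ ((m : ℝ) * μ) := by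
      have h := Finset.card_le_univ (univ.image B.mulVec)
      rw [Fintype.card_fun, Fintype.card_fin] at h
      calc (#(univ.image B.mulVec) : ℝ) ≤ (Fintype.card F : ℝ) ^ (m * μ) := by exact_mod_cast h
        _ = _ := by rw [← Nat.cast_mul, Real.rpow_natCast]
    rw [mul_right_comm, Real.rpow_mul (Nat.cast_nonneg _)]
    exact Real.rpow_le_rpow (Nat.cast_nonneg _) hcard hρ0.le
end

section
/- Let q be a prime power, let ℓ be a bijective F_q-linear map on F_q^{mn}, let B be an (mμ) × (mn) matrix over F_q, let S be uniformly distributed on F_q^{mn} (identified with Π_{i=1}^{T+1} F_q^{k_i} where k_1+⋯+k_{T+1} = mn), let 𝒾 ⊆ {1,…,T} be nonempty, and let α_𝒾 be the projection from Π_{i=1}^{T+1} F_q^{k_i} onto Π_{i∈𝒾} F_q^{k_i}. Then: conditioned on any realization z of B ℓ S^t, the random variable S_𝒾 = α_𝒾(S) is uniformly distributed on the affine set α_𝒾(ker(Bℓ)) + α_𝒾(v) for any v with Bℓv^t = z; consequently both H(S_𝒾) and H(S_𝒾 | B ℓ S^t) are integer multiples of ln q, and hence the mutual information I(S_𝒾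 ; B ℓ S^t) is an integer multiple of ln q. -/
open scoped Classical
open Finset

/-- The concatenation map as a linear map. -/
noncomputable def concatLinear {T m n : ℕ} {F : Type*} [Field F] (k : Fin (T + 1) → ℕ)
    (h : ∑ i, k i = m * n) : (∀ i, Fin (k i) → F) →ₗ[F] (Fin (m * n) → F) where
  toFun := concat k h
  map_add' _ _ := rfl
  map_smul' _ _ := rfl

theorem mprob_comp {Ω V W : Type*} [Fintype Ω] [Fintype V] (p : Ω → ℝ) (S : Ω → V)
    (h : V → W) (a : W) :
    mprob p (fun ω => h (S ω)) a = ∑ s, if h s = a then mprob p S s else 0 := by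
  unfold mprob
  have key : ∀ s, (if h s = a then ∑ ω, (if S ω = s then p ω else 0) else 0)
      = ∑ ω, if S ω = s then (if h (S ω) = a then p ω else 0) else 0 := by
    intro s
    by_cases hs : h s = a
    · simp only [hs, if_true]
      refine Finset.sum_congr rfl fun ω _ => ?_
      by_cases hω : S ω = s
      · simp [hω, hs]
      · simp [hω]
    · simp only [hs, if_false]
      refine (Finset.sum_eq_zero fun ω _ => ?_).symm
      by_cases hω : S ω = s
      · simp [hω, hs]
      · simp [hω]
  simp_rw [key]
  rw [Finset.sum_comm]
  simp

theorem jprob_eq_mprob_prod {Ω 𝒳 𝒴 : Type*} [Fintype Ω] (p : Ω → ℝ) (X : Ω → 𝒳) (Y : Ω → 𝒴)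
    (x : 𝒳) (y : 𝒴) : jprob p X Y x y = mprob p (fun ω => (X ω, Y ω)) (x, y) := by
  simp [jprob, mprob, Prod.ext_iff]

section Linear

variable {F V W Z : Type*} [Field F] [AddCommGroup V] [Module F V]
  [AddCommGroup W] [Module F W] [AddCommGroup Z] [Module F Z]

theorem card_fiber_mul_card_range [Finite V] (h : V →ₗ[F] W) (v : V) :
    Nat.card {s // h s = h v} * Nat.card (LinearMap.range h) = Nat.card V := by
  have e : {s // h s = h v} ≃ LinearMap.ker h :=
    { toFun := fun s => ⟨s.1 - v, by simp [s.2]⟩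
      invFun := fun s => ⟨s.1 + v, by simp⟩
      left_inv := fun s => by simp
      right_inv := fun s => by simp }
  rw [Nat.card_congr e, Submodule.card_eq_card_quotient_mul_card (LinearMap.ker h),
    Nat.card_congr h.quotKerEquivRange.toEquiv]

theorem finrank_range_prod [FiniteDimensional F V] (g : V →ₗ[F] W) (f : V →ₗ[F] Z) :
    Module.finrank F (LinearMap.range (g.prod f))
      = Module.finrank F ((LinearMap.ker f).map g) + Module.finrank F (LinearMap.range f) := by
  have h1 := (g.prod f).finrank_range_add_finrank_ker
  have h2 := f.finrank_range_add_finrank_ker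
  have h3 := (g.domRestrict (LinearMap.ker f)).finrank_range_add_finrank_ker
  have h4 : Module.finrank F (LinearMap.ker (g.domRestrict (LinearMap.ker f)))
      = Module.finrank F (LinearMap.ker (g.prod f)) := by
    have hd : LinearMap.ker (g.domRestrict (LinearMap.ker f))
        = (LinearMap.ker (g.prod f)).comap (LinearMap.ker f).subtype := by
      ext x
      simp
    have hle : LinearMap.ker (g.prod f) ≤ LinearMap.ker f := by
      rw [LinearMap.ker_prod]
      exact inf_le_right
    rw [hd, (Submodule.comapSubtypeEquivOfLe hle).finrank_eq]
  rw [LinearMap.range_domRestrict] at h3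
  omega

theorem finrank_map_ker_le [FiniteDimensional F V] (g : V →ₗ[F] W) (f : V →ₗ[F] Z) :
    Module.finrank F ((LinearMap.ker f).map g) ≤ Module.finrank F (LinearMap.range g) :=
  Submodule.finrank_mono LinearMap.map_le_range

theorem log_card_eq_finrank_mul [Fintype F] [Module.Finite F V] :
    Real.log (Nat.card V) = (Module.finrank F V : ℝ) * Real.log (Fintype.card F) := by
  rw [Module.natCard_eq_pow_finrank (K := F) (V := V), Nat.card_eq_fintype_card]
  push_cast
  rw [Real.log_pow]

theorem card_range_prod [Finite F] [FiniteDimensional F V] (g : V →ₗ[F] W) (f : V →ₗ[F] Z) :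
    Nat.card (LinearMap.range (g.prod f))
      = Nat.card ((LinearMap.ker f).map g) * Nat.card (LinearMap.range f) := by
  rw [Module.natCard_eq_pow_finrank (K := F) (V := LinearMap.range (g.prod f)),
    Module.natCard_eq_pow_finrank (K := F) (V := (LinearMap.ker f).map g),
    Module.natCard_eq_pow_finrank (K := F) (V := LinearMap.range f), finrank_range_prod, pow_add]

theorem ncard_translate_map_ker (g : V →ₗ[F] W) (f : V →ₗ[F] Z) (w : W) :
    {a | ∃ s, f s = 0 ∧ a = g s + w}.ncard = Nat.card ((LinearMap.ker f).map g) := by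
  have : {a | ∃ s, f s = 0 ∧ a = g s + w}
      = (fun x => x + w) '' ((LinearMap.ker f).map g : Set W) := by
    ext a
    constructor
    · rintro ⟨s, hs, rfl⟩
      exact ⟨g s, ⟨s, hs, rfl⟩, rfl⟩
    · rintro ⟨_, ⟨s, hs, rfl⟩, rfl⟩
      exact ⟨s, hs, rfl⟩
  rw [this, Set.ncard_image_of_injective _ (add_left_injective w), ← Nat.card_coe_set_eq]
  rfl

theorem mem_range_prod_iff (g : V →ₗ[F] W) (f : V →ₗ[F] Z) (v : V) (a : W) :
    (a, f v) ∈ LinearMap.range (g.prod f) ↔ ∃ s, f s = 0 ∧ a = g s + g v := by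
  constructor
  · rintro ⟨s, hs⟩
    obtain ⟨rfl, hf⟩ := Prod.ext_iff.1 hs
    exact ⟨s - v, by simpa [sub_eq_zero] using hf, by simp⟩
  · rintro ⟨s, hs, rfl⟩
    exact ⟨s + v, by simp [hs]⟩

variable {Ω : Type*} [Fintype Ω] {p : Ω → ℝ} {S : Ω → V}

/-- The image of a uniform random vector under a linear map is uniform on the range. -/
theorem mprob_linear_of_uniform [Fintype V] (hS : ∀ s, mprob p S s = 1 / (Fintype.card V : ℝ))
    (h : V →ₗ[F] W) (a : W) :
    mprob p (fun ω => h (S ω)) a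
      = if a ∈ LinearMap.range h then 1 / (Nat.card (LinearMap.range h) : ℝ) else 0 := by
  rw [mprob_comp p S h a]
  simp_rw [hS]
  split_ifs with ha
  · obtain ⟨v, rfl⟩ := ha
    have hc := card_fiber_mul_card_range h v
    have hV : (Nat.card V : ℝ) ≠ 0 := by
      exact_mod_cast Nat.card_pos.ne'
    have hc' : (Nat.card {s // h s = h v} : ℝ) * Nat.card (LinearMap.range h) = Nat.card V := by
      exact_mod_cast hc
    have hR : (Nat.card (LinearMap.range h) : ℝ) ≠ 0 := right_ne_zero_of_mul (hc' ▸ hV)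
    rw [← Finset.sum_filter, Finset.sum_const, nsmul_eq_mul, ← Nat.card_eq_fintype_card,
      ← Fintype.card_subtype, ← Nat.card_eq_fintype_card]
    field_simp
    exact hc'
  · exact Finset.sum_eq_zero fun s _ => if_neg fun hs => ha ⟨s, hs⟩

theorem jprob_linear_of_uniform [Fintype V] (hS : ∀ s, mprob p S s = 1 / (Fintype.card V : ℝ))
    (g : V →ₗ[F] W) (f : V →ₗ[F] Z) (a : W) (z : Z) :
    jprob p (fun ω => g (S ω)) (fun ω => f (S ω)) a z
      = if (a, z) ∈ LinearMap.range (g.prod f)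
        then 1 / (Nat.card (LinearMap.range (g.prod f)) : ℝ) else 0 := by
  rw [jprob_eq_mprob_prod]
  exact mprob_linear_of_uniform hS (g.prod f) (a, z)

theorem cprob_linear_of_uniform [Finite F] [Fintype V]
    (hS : ∀ s, mprob p S s = 1 / (Fintype.card V : ℝ))
    (g : V →ₗ[F] W) (f : V →ₗ[F] Z) (v : V) (a : W) :
    cprob p (fun ω => g (S ω)) (fun ω => f (S ω)) a (f v)
      = if a ∈ {a' | ∃ s, f s = 0 ∧ a' = g s + g v}
        then 1 / ({a' | ∃ s, f s = 0 ∧ a' = g s + g v}.ncard : ℝ) else 0 := by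
  rw [cprob, jprob_linear_of_uniform hS, mprob_linear_of_uniform hS,
    if_pos (LinearMap.mem_range_self f v), ncard_translate_map_ker, card_range_prod]
  simp only [mem_range_prod_iff, Set.mem_ofPred_eq]
  have : Finite (LinearMap.range f) := Set.finite_range f
  have hf : (Nat.card (LinearMap.range f) : ℝ) ≠ 0 := by exact_mod_cast Nat.card_pos.ne'
  split_ifs
  · push_cast
    field_simp
  · simp

theorem sum_ite_mem_const [Fintype W] (M : Submodule F W) (c : ℝ) :
    ∑ a, (if a ∈ M then 1 / (Nat.card M : ℝ) * c else 0) = c := by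
  have hM : (Nat.card M : ℝ) ≠ 0 := by exact_mod_cast Nat.card_pos.ne'
  rw [← Finset.sum_filter, Finset.sum_const, nsmul_eq_mul, ← Fintype.card_subtype,
    ← Nat.card_eq_fintype_card]
  change (Nat.card M : ℝ) * _ = c
  field_simp

theorem entropy_linear_of_uniform [Fintype V] [Fintype W]
    (hS : ∀ s, mprob p S s = 1 / (Fintype.card V : ℝ)) (g : V →ₗ[F] W) :
    entropy p (fun ω => g (S ω)) = Real.log (Nat.card (LinearMap.range g)) := by
  rw [entropy, ← sum_ite_mem_const (LinearMap.range g) (Real.log (Nat.card (LinearMap.range g))),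
    ← Finset.sum_neg_distrib]
  refine Finset.sum_congr rfl fun a _ => ?_
  rw [mprob_linear_of_uniform hS]
  split_ifs <;> simp

theorem condEntropy_linear_of_uniform [Finite F] [Fintype V] [Fintype W] [Fintype Z]
    (hS : ∀ s, mprob p S s = 1 / (Fintype.card V : ℝ)) (g : V →ₗ[F] W) (f : V →ₗ[F] Z) :
    condEntropy p (fun ω => g (S ω)) (fun ω => f (S ω))
      = Real.log (Nat.card ((LinearMap.ker f).map g)) := by
  rw [condEntropy, ← sum_ite_mem_const (LinearMap.range (g.prod f))
    (Real.log (Nat.card ((LinearMap.ker f).map g))), ← Fintype.sum_prod_type',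
    ← Finset.sum_neg_distrib]
  refine Finset.sum_congr rfl fun x _ => ?_
  obtain ⟨a, z⟩ := x
  rw [jprob_linear_of_uniform hS]
  split_ifs with hx
  · obtain ⟨v, hv⟩ := id hx
    obtain ⟨-, rfl⟩ := Prod.ext_iff.1 hv
    have hmem := (mem_range_prod_iff g f v a).1 hx
    change -(_ * Real.log (cprob p _ _ a (f v))) = _
    rw [cprob_linear_of_uniform hS, if_pos (Set.mem_ofPred_eq ▸ hmem), ncard_translate_map_ker]
    simp
  · simp

theorem mutInfo_linear_of_uniform [Finite F] [Fintype V] [Fintype W] [Fintype Z]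
    (hS : ∀ s, mprob p S s = 1 / (Fintype.card V : ℝ)) (g : V →ₗ[F] W) (f : V →ₗ[F] Z) :
    mutInfo p (fun ω => g (S ω)) (fun ω => f (S ω))
      = Real.log (Nat.card (LinearMap.range g))
        - Real.log (Nat.card ((LinearMap.ker f).map g)) := by
  have hg : (Nat.card (LinearMap.range g) : ℝ) ≠ 0 := by exact_mod_cast Nat.card_pos.ne'
  have hk : (Nat.card ((LinearMap.ker f).map g) : ℝ) ≠ 0 := by exact_mod_cast Nat.card_pos.ne'
  rw [← Real.log_div hg hk, mutInfo, ← Fintype.sum_prod_type',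
    ← sum_ite_mem_const (LinearMap.range (g.prod f)) (Real.log (_ / _))]
  refine Finset.sum_congr rfl fun x _ => ?_
  obtain ⟨a, z⟩ := x
  rw [jprob_linear_of_uniform hS]
  split_ifs with hx
  · obtain ⟨v, hv⟩ := id hx
    obtain ⟨rfl, rfl⟩ := Prod.ext_iff.1 hv
    have hf : (Nat.card (LinearMap.range f) : ℝ) ≠ 0 := by exact_mod_cast Nat.card_pos.ne'
    congr 2
    change _ / (mprob p _ (g v) * mprob p _ (f v)) = _
    rw [mprob_linear_of_uniform hS, mprob_linear_of_uniform hS,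
      if_pos (LinearMap.mem_range_self g v), if_pos (LinearMap.mem_range_self f v),
      card_range_prod]
    push_cast
    field_simp
  · simp

end Linear

/-- Let `ℓ` be a bijective linear map on `F_q^{mn}`, `B` an
`(mμ) × (mn)` matrix, and let `S` be uniform on `Π_i F_q^{k_i}` (identified with
`F_q^{mn}` via concatenation). Then conditioned on any realization `z` of the
observation `BℓSᵗ`, the projection `S_𝒾 = α_𝒾(S)` is uniformly distributed on
`α_𝒾(ker(Bℓ)) + α_𝒾(v)` for any `v` with `Bℓvᵗ = z`; consequently `H(S_𝒾)`,
`H(S_𝒾 | BℓSᵗ)` and `I(S_𝒾 ; BℓSᵗ)` are integer multiples of `ln q`. -/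
theorem uniform_message_mutual_info_multiple_log_q
    {F : Type*} [Field F] [Fintype F] [DecidableEq F]
    (m n T μ : ℕ) (hm : 0 < m) (hn : 0 < n) (hT : 0 < T) (hμ : 0 < μ)
    (k : Fin (T + 1) → ℕ) (hkpos : ∀ i, 0 < k i) (hk : ∑ i, k i = m * n)
    {Ω : Type*} [Fintype Ω] (p : Ω → ℝ) (hp0 : ∀ ω, 0 ≤ p ω) (hp1 : ∑ ω, p ω = 1)
    (S : Ω → (∀ i : Fin (T + 1), Fin (k i) → F))
    -- S is uniformly distributed on Π_i F_q^{k_i} ≅ F_q^{mn}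
    (hSunif : ∀ s, mprob p S s
      = 1 / (Fintype.card (∀ i : Fin (T + 1), Fin (k i) → F) : ℝ))
    (ℓ : GL (Fin (m * n)) F)
    (B : Matrix (Fin (m * μ)) (Fin (m * n)) F)
    (𝒾 : Finset (Fin (T + 1))) (h𝒾 : 𝒾.Nonempty) (h𝒾' : Fin.last T ∉ 𝒾) :
    -- (a) conditional uniformity on the affine set α_𝒾(ker(Bℓ)) + α_𝒾(v)
    (∀ z : Fin (m * μ) → F,
      mprob p (fun ω => B.mulVec
          ((ℓ : Matrix (Fin (m * n)) (Fin (m * n)) F).mulVec (concat k hk (S ω)))) z ≠ 0 →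
      ∀ v : ∀ i : Fin (T + 1), Fin (k i) → F,
        B.mulVec ((ℓ : Matrix (Fin (m * n)) (Fin (m * n)) F).mulVec (concat k hk v)) = z →
        ∀ a : ∀ i : 𝒾, Fin (k i.1) → F,
          cprob p (fun ω => fun i : 𝒾 => S ω i.1)
            (fun ω => B.mulVec
              ((ℓ : Matrix (Fin (m * n)) (Fin (m * n)) F).mulVec (concat k hk (S ω)))) a z
          = if a ∈ {a' : ∀ i : 𝒾, Fin (k i.1) → F |
                ∃ s : ∀ i : Fin (T + 1), Fin (k i) → F,
                  B.mulVec ((ℓ : Matrix (Fin (m * n)) (Fin (m * n)) F).mulVec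
                    (concat k hk s)) = 0
                  ∧ a' = (fun i : 𝒾 => s i.1) + (fun i : 𝒾 => v i.1)}
            then 1 / (({a' : ∀ i : 𝒾, Fin (k i.1) → F |
                ∃ s : ∀ i : Fin (T + 1), Fin (k i) → F,
                  B.mulVec ((ℓ : Matrix (Fin (m * n)) (Fin (m * n)) F).mulVec
                    (concat k hk s)) = 0
                  ∧ a' = (fun i : 𝒾 => s i.1) + (fun i : 𝒾 => v i.1)}.ncard : ℝ))
            else 0)
    -- (b) entropies and mutual information are integer multiples of ln q
    ∧ (∃ a b c : ℕ,
        entropy p (fun ω => fun i : 𝒾 => S ω i.1)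
          = (a : ℝ) * Real.log (Fintype.card F)
        ∧ condEntropy p (fun ω => fun i : 𝒾 => S ω i.1)
            (fun ω => B.mulVec
              ((ℓ : Matrix (Fin (m * n)) (Fin (m * n)) F).mulVec (concat k hk (S ω))))
          = (b : ℝ) * Real.log (Fintype.card F)
        ∧ mutInfo p (fun ω => fun i : 𝒾 => S ω i.1)
            (fun ω => B.mulVec
              ((ℓ : Matrix (Fin (m * n)) (Fin (m * n)) F).mulVec (concat k hk (S ω))))
          = (c : ℝ) * Real.log (Fintype.card F)) := by
  obtain ⟨f, hf⟩ : ∃ f : (∀ i : Fin (T + 1), Fin (k i) → F) →ₗ[F] (Fin (m * μ) → F),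
      ∀ s, f s = B.mulVec
        ((ℓ : Matrix (Fin (m * n)) (Fin (m * n)) F).mulVec (concat k hk s)) :=
    ⟨B.mulVecLin ∘ₗ (ℓ : Matrix (Fin (m * n)) (Fin (m * n)) F).mulVecLin ∘ₗ concatLinear k hk,
      fun _ => rfl⟩
  obtain ⟨g, hg⟩ : ∃ g : (∀ i : Fin (T + 1), Fin (k i) → F) →ₗ[F] (∀ i : 𝒾, Fin (k i.1) → F),
      ∀ s, g s = fun i : 𝒾 => s i.1 :=
    ⟨LinearMap.pi fun i => LinearMap.proj i.1, fun _ => rfl⟩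
  have hentropy := entropy_linear_of_uniform hSunif g
  have hcond := condEntropy_linear_of_uniform hSunif g f
  have hinfo := mutInfo_linear_of_uniform hSunif g f
  simp only [hg] at hentropy hcond hinfo
  simp only [← hf]
  refine ⟨?_, Module.finrank F (LinearMap.range g),
    Module.finrank F ((LinearMap.ker f).map g),
    Module.finrank F (LinearMap.range g) - Module.finrank F ((LinearMap.ker f).map g), ?_, ?_, ?_⟩
  · rintro z - v rfl a
    have hcprob := cprob_linear_of_uniform hSunif g f v a
    simp only [hg] at hcprob
    exact hcprob
  · rw [hentropy, log_card_eq_finrank_mul (F := F)]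
  · rw [hcond, log_card_eq_finrank_mul (F := F)]
  · rw [hinfo, Nat.cast_sub (finrank_map_ker_le g f), sub_mul,
      log_card_eq_finrank_mul (F := F), log_card_eq_finrank_mul (F := F)]
end
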